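/- Every solution v of the ODE (O6) defined on all of ℝ is bounded: there exists M > 0 such that |v(t)| ≤ M for all t ∈ ℝ. -/

import Mathlib

noncomputable section

open Real

def cN (n : ℕ) : ℝ := (n : ℝ) * ((n : ℝ) - 6) * ((n : ℝ) ^ 4 - 20 * (n : ℝ) ^ 2 + 64) / 64
def K0 (n : ℕ) : ℝ := ((n : ℝ) - 6) ^ 2 * ((n : ℝ) - 2) ^ 2 * ((n : ℝ) + 2) ^ 2 / 64
def K2 (n : ℕ) : ℝ := (3 * (n : ℝ) ^ 4 - 24 * (n : ℝ) ^ 3 + 72 * (n : ℝ) ^ 2 - 96 * (n : ℝ) + 304) / 16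
def K4 (n : ℕ) : ℝ := (3 * (n : ℝ) ^ 2 - 12 * (n : ℝ) + 44) / 4

/-- `v` is a (classical, entire) solution of the sixth order ODE (O6). -/
def IsSolO6 (n : ℕ) (v : ℝ → ℝ) : Prop :=
  ContDiff ℝ 6 v ∧ ∀ t : ℝ,
    iteratedDeriv 6 v t - K4 n * iteratedDeriv 4 v t + K2 n * iteratedDeriv 2 v t
      - K0 n * v t + cN n * |v t| ^ (12 / ((n : ℝ) - 6)) * v t = 0

/-- Weighted Young inequality with a bounded coefficient. -/
theorem neg_weighted_sq_le_mul {c C ε : ℝ} (hc : |c| ≤ C) (hε : 0 < ε) (x y : ℝ) :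
    -(ε * x ^ 2 + C ^ 2 / (4 * ε) * y ^ 2) ≤ c * x * y := by
  have h1 : c ^ 2 ≤ C ^ 2 := sq_le_sq' (by linarith [neg_abs_le c]) (le_trans (le_abs_self c) hc)
  have h2 : 0 ≤ (2 * ε * x + c * y) ^ 2 / (4 * ε) := by positivity
  have h3 : (2 * ε * x + c * y) ^ 2 / (4 * ε)
      = ε * x ^ 2 + c * x * y + c ^ 2 / (4 * ε) * y ^ 2 := by
    field_simp
    ring
  have h4 : c ^ 2 / (4 * ε) * y ^ 2 ≤ C ^ 2 / (4 * ε) * y ^ 2 := by gcongr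
  linarith

theorem neg_mul_sq_le {c C : ℝ} (hc : |c| ≤ C) (x : ℝ) : -(C * x ^ 2) ≤ c * x ^ 2 := by
  nlinarith [sq_nonneg x, neg_abs_le c]

/-- A linear function is dominated by a superlinear power up to a constant. -/
theorem exists_mul_le_mul_rpow_add {q κ : ℝ} (hq : 1 < q) (hκ : 0 < κ) (l : ℝ) :
    ∃ M : ℝ, ∀ y : ℝ, 0 ≤ y → l * y ≤ κ * y ^ q + M := by
  set Y : ℝ := (|l| / κ) ^ (1 / (q - 1)) with hY
  have hY0 : 0 ≤ Y := by positivity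
  refine ⟨|l| * Y, fun y hy => ?_⟩
  have h1 : l * y ≤ |l| * y := mul_le_mul_of_nonneg_right (le_abs_self l) hy
  rcases le_or_gt y Y with h | h
  · have h2 : |l| * y ≤ |l| * Y := by gcongr
    have h3 : 0 ≤ κ * y ^ q := by positivity
    linarith
  · have hy0 : 0 < y := lt_of_le_of_lt hY0 h
    have h2 : Y ^ (q - 1) ≤ y ^ (q - 1) := rpow_le_rpow hY0 h.le (by linarith)
    have h3 : Y ^ (q - 1) = |l| / κ := by
      rw [hY, ← rpow_mul (by positivity), one_div_mul_cancel (by linarith), rpow_one]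
    have h4 : y ^ q = y ^ (q - 1) * y := by
      rw [← rpow_add_one hy0.ne']; simp
    have h5 : |l| ≤ κ * y ^ (q - 1) := by
      rw [h3, div_le_iff₀ hκ] at h2; linarith
    have h6 : |l| * y ≤ κ * y ^ (q - 1) * y := by gcongr
    have h7 : 0 ≤ |l| * Y := by positivity
    rw [h4]; linarith

/-- Coercivity, modulo exact derivatives and the lowest order term, of the quadratic form that
arises by multiplying the energy with a power of a cutoff `ψ` with `ψ' = s`. -/
theorem exists_quadratic_coercivity (k₄ k₂ k₀ m : ℝ) :
    ∃ β γ δ : ℝ, ∀ ψ s y₀ y₁ y₂ y₃ : ℝ, 0 ≤ ψ → ψ ≤ 1 → |s| ≤ 2 →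
      y₀ ^ 2 + y₁ ^ 2 ≤ δ * y₀ ^ 2 + β * (y₂ ^ 2 + y₁ * y₃ + (m + 4) * s * y₁ * y₂)
        + γ * (y₁ ^ 2 + y₀ * y₂ + (m + 2) * s * y₀ * y₁)
        + (5 / 2 * y₃ ^ 2 + 3 * (m + 6) * s * y₂ * y₃
          + (m + 6) * ((m + 5) * s ^ 2 - 2 * ψ) * y₁ * y₃
          - k₄ * (ψ ^ 2 * y₁ * y₃ - 1 / 2 * ψ ^ 2 * y₂ ^ 2)
          + k₂ / 2 * ψ ^ 4 * y₁ ^ 2 - k₀ / 2 * ψ ^ 6 * y₀ ^ 2) := by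
  set C₁ : ℝ := 6 * |m + 6| with hC₁
  set C₂ : ℝ := |m + 6| * (4 * |m + 5| + 2) + |k₄| with hC₂
  set β : ℝ := C₁ ^ 2 / 2 + |k₄| / 2 + 2 with hβ
  set C₃ : ℝ := |β| * (2 * |m + 4|) with hC₃
  set γ : ℝ := C₂ ^ 2 / 2 + |k₂| / 2 + β ^ 2 / 4 + C₃ ^ 2 / 4 + 2 with hγ
  set C₄ : ℝ := |γ| * (2 * |m + 2|) with hC₄
  refine ⟨β, γ, 1 + |k₀| / 2 + γ ^ 2 / 4 + C₄ ^ 2 / 4, ?_⟩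
  intro ψ s y₀ y₁ y₂ y₃ hψ0 hψ1 hs
  have hpow (j : ℕ) : |ψ ^ j| ≤ 1 := by
    rw [abs_of_nonneg (by positivity)]; exact pow_le_one₀ hψ0 hψ1
  have hs2 : |s ^ 2| ≤ 4 := by rw [abs_pow]; nlinarith [abs_nonneg s]
  have hψ : |ψ| ≤ 1 := by simpa using hpow 1
  have b1 : |3 * (m + 6) * s| ≤ C₁ := by
    rw [abs_mul, abs_mul, abs_of_pos (by norm_num : (0 : ℝ) < 3), hC₁]
    nlinarith [abs_nonneg (m + 6)]
  have b2 : |(m + 6) * ((m + 5) * s ^ 2 - 2 * ψ) - k₄ * ψ ^ 2| ≤ C₂ := by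
    have e1 : |(m + 5) * s ^ 2 - 2 * ψ| ≤ 4 * |m + 5| + 2 := by
      refine (abs_sub _ _).trans ?_
      rw [abs_mul, abs_mul, abs_of_pos (by norm_num : (0 : ℝ) < 2)]
      nlinarith [abs_nonneg (m + 5)]
    refine (abs_sub _ _).trans ?_
    rw [abs_mul, abs_mul k₄, hC₂]
    have e2 : |m + 6| * |(m + 5) * s ^ 2 - 2 * ψ| ≤ |m + 6| * (4 * |m + 5| + 2) := by gcongr
    have e3 : |k₄| * |ψ ^ 2| ≤ |k₄| * 1 := mul_le_mul_of_nonneg_left (hpow 2) (abs_nonneg _)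
    linarith
  have b3 : |β * (m + 4) * s| ≤ C₃ := by
    rw [abs_mul, abs_mul, hC₃]
    clear_value β
    linarith [mul_le_mul_of_nonneg_left hs (mul_nonneg (abs_nonneg β) (abs_nonneg (m + 4)))]
  have b4 : |γ * (m + 2) * s| ≤ C₄ := by
    rw [abs_mul, abs_mul, hC₄]
    clear_value γ
    linarith [mul_le_mul_of_nonneg_left hs (mul_nonneg (abs_nonneg γ) (abs_nonneg (m + 2)))]
  have b5 (k : ℝ) (j : ℕ) : |k / 2 * ψ ^ j| ≤ |k| / 2 := by
    rw [abs_mul, abs_div, abs_of_pos (by norm_num : (0 : ℝ) < 2)]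
    nlinarith [hpow j, abs_nonneg k]
  have b6 : |-(k₀ / 2 * ψ ^ 6)| ≤ |k₀| / 2 := by rw [abs_neg]; exact b5 k₀ 6
  have i1 := neg_weighted_sq_le_mul b1 (by norm_num : (0 : ℝ) < 1 / 2) y₃ y₂
  have i2 := neg_weighted_sq_le_mul b2 (by norm_num : (0 : ℝ) < 1 / 2) y₃ y₁
  have i3 := neg_weighted_sq_le_mul b3 one_pos y₂ y₁
  have i4 := neg_weighted_sq_le_mul b4 one_pos y₁ y₀
  have i5 := neg_mul_sq_le (b5 k₄ 2) y₂
  have i6 := neg_mul_sq_le (b5 k₂ 4) y₁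
  have i7 := neg_mul_sq_le b6 y₀
  have i8 : 0 ≤ (y₃ + β / 2 * y₁) ^ 2 := sq_nonneg _
  have i9 : 0 ≤ (y₂ + γ / 2 * y₀) ^ 2 := sq_nonneg _
  have eβ : β * y₂ ^ 2 = (C₁ ^ 2 / 2 + |k₄| / 2 + 2) * y₂ ^ 2 := by rw [hβ]
  have eγ : γ * y₁ ^ 2
      = (C₂ ^ 2 / 2 + |k₂| / 2 + β ^ 2 / 4 + C₃ ^ 2 / 4 + 2) * y₁ ^ 2 := by rw [hγ]
  clear_value C₁ C₂ C₃ C₄ β γ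
  linarith [sq_nonneg y₃]

/-- Interior estimate: a function with prescribed energy `e` near the origin is bounded at the
origin by a constant that depends only on the energy and on the parameters. -/
theorem exists_sq_le_of_energy_eq (k₄ k₂ k₀ κ e : ℝ) (hκ : 0 < κ) (m : ℕ) (hm : 0 < m) :
    ∃ M : ℝ, ∀ v₀ v₁ v₂ v₃ v₄ v₅ : ℝ → ℝ,
      (∀ t, HasDerivAt v₀ (v₁ t) t) → (∀ t, HasDerivAt v₁ (v₂ t) t) →
      (∀ t, HasDerivAt v₂ (v₃ t) t) → (∀ t, HasDerivAt v₃ (v₄ t) t) →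
      (∀ t, HasDerivAt v₄ (v₅ t) t) →
      (∀ t, v₁ t * v₅ t - v₂ t * v₄ t + 1 / 2 * v₃ t ^ 2
        - k₄ * (v₁ t * v₃ t - 1 / 2 * v₂ t ^ 2) + k₂ / 2 * v₁ t ^ 2 - k₀ / 2 * v₀ t ^ 2
        + κ * |v₀ t| ^ (12 / (m : ℝ) + 2) = e) →
      v₀ 0 ^ 2 ≤ M := by
  have hm' : (0 : ℝ) < m := by exact_mod_cast hm
  obtain ⟨β, γ, δ, hquad⟩ := exists_quadratic_coercivity k₄ k₂ k₀ m
  obtain ⟨M₁, hM₁⟩ := exists_mul_le_mul_rpow_add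
    (q := 6 / (m : ℝ) + 1) (by have : 0 < 6 / (m : ℝ) := by positivity
                               linarith) hκ δ
  set M₀ : ℝ := |e| + M₁ with hM₀
  set A : ℝ := 2 * m + 5 with hA
  refine ⟨2 * A * M₀, ?_⟩
  intro v₀ v₁ v₂ v₃ v₄ v₅ h0 h1 h2 h3 h4 hE
  have hψ (t : ℝ) : HasDerivAt (fun t : ℝ => 1 - t ^ 2) (-(2 * t)) t := by
    simpa using (hasDerivAt_pow 2 t).const_sub 1
  have hψp (j : ℕ) (t : ℝ) : HasDerivAt (fun t : ℝ => (1 - t ^ 2) ^ (j + 1))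
      ((j + 1) * (1 - t ^ 2) ^ j * (-(2 * t))) t := by
    exact ((hψ t).fun_pow (j + 1)).congr_deriv (by push_cast; simp)
  set S : ℝ → ℝ := fun t =>
    β * ((1 - t ^ 2) ^ (m + 3 + 1) * (v₁ t * v₂ t))
      + γ * ((1 - t ^ 2) ^ (m + 1 + 1) * (v₀ t * v₁ t))
      - ((1 - t ^ 2) ^ (m + 5 + 1) * (v₁ t * v₄ t - 2 * (v₂ t * v₃ t))
        - (m + 6) * ((1 - t ^ 2) ^ (m + 4 + 1) * (-(2 * t))) * (v₁ t * v₃ t))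
      + M₀ * t with hS
  set S' : ℝ → ℝ := fun t =>
    (1 - t ^ 2) ^ m * (
      β * ((1 - t ^ 2) ^ 4 * (v₂ t ^ 2 + v₁ t * v₃ t)
        + (m + 4) * (1 - t ^ 2) ^ 3 * (-(2 * t)) * (v₁ t * v₂ t))
      + γ * ((1 - t ^ 2) ^ 2 * (v₁ t ^ 2 + v₀ t * v₂ t)
        + (m + 2) * (1 - t ^ 2) * (-(2 * t)) * (v₀ t * v₁ t))
      - (1 - t ^ 2) ^ 6 * (v₁ t * v₅ t - v₂ t * v₄ t - 2 * v₃ t ^ 2)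
      + 3 * (m + 6) * (1 - t ^ 2) ^ 5 * (-(2 * t)) * (v₂ t * v₃ t)
      + (m + 6) * ((m + 5) * (1 - t ^ 2) ^ 4 * (2 * t) ^ 2 - 2 * (1 - t ^ 2) ^ 5)
        * (v₁ t * v₃ t)) + M₀ with hS'
  have hSd (t : ℝ) : HasDerivAt S (S' t) t := by
    have d1 := ((hψp (m + 3) t).fun_mul ((h1 t).fun_mul (h2 t))).const_mul β
    have d2 := ((hψp (m + 1) t).fun_mul ((h0 t).fun_mul (h1 t))).const_mul γ
    have d3 := (hψp (m + 5) t).fun_mul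
      (((h1 t).fun_mul (h4 t)).fun_sub (((h2 t).fun_mul (h3 t)).const_mul 2))
    have d5 : HasDerivAt (fun t : ℝ => -(2 * t)) (-2) t := by
      simpa using ((hasDerivAt_id' t).const_mul 2).fun_neg
    have d4 := (((hψp (m + 4) t).fun_mul d5).const_mul ((m : ℝ) + 6)).fun_mul
      ((h1 t).fun_mul (h3 t))
    have d := ((d1.fun_add d2).fun_sub (d3.fun_sub d4)).fun_add
      ((hasDerivAt_id' t).const_mul M₀)
    refine d.congr_deriv ?_
    simp only [hS']
    push_cast
    generalize 1 - t ^ 2 = p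
    ring
  set J : ℝ → ℝ := fun t => A * S t - (1 - t ^ 2) ^ (m + 1 + 1) * (v₀ t * v₀ t) with hJ
  have hJd (t : ℝ) : HasDerivAt J (A * S' t
      - (1 - t ^ 2) ^ m * ((m + 2) * (1 - t ^ 2) * (-(2 * t)) * (v₀ t * v₀ t)
        + 2 * (1 - t ^ 2) ^ 2 * (v₀ t * v₁ t))) t := by
    have d := ((hSd t).const_mul A).fun_sub
      ((hψp (m + 1) t).fun_mul ((h0 t).fun_mul (h0 t)))
    refine d.congr_deriv ?_
    push_cast
    generalize 1 - t ^ 2 = p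
    ring
  have key (t : ℝ) (ht : t ∈ Set.Icc (-1 : ℝ) 1) :
      (1 - t ^ 2) ^ m * (v₀ t ^ 2 + ((1 - t ^ 2) * v₁ t) ^ 2) ≤ S' t := by
    have hp0 : 0 ≤ 1 - t ^ 2 := by nlinarith [ht.1, ht.2]
    have hp1 : 1 - t ^ 2 ≤ 1 := by nlinarith [sq_nonneg t]
    have hs : |-(2 * t)| ≤ 2 := by rw [abs_le]; constructor <;> linarith [ht.1, ht.2]
    have hq := hquad (1 - t ^ 2) (-(2 * t)) (v₀ t) ((1 - t ^ 2) * v₁ t)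
      ((1 - t ^ 2) ^ 2 * v₂ t) ((1 - t ^ 2) ^ 3 * v₃ t) hp0 hp1 hs
    have hr : 0 ≤ (1 - t ^ 2) ^ m := pow_nonneg hp0 m
    have hY := hM₁ ((1 - t ^ 2) ^ m * v₀ t ^ 2) (by positivity)
    have hpow : ((1 - t ^ 2) ^ m * v₀ t ^ 2) ^ (6 / (m : ℝ) + 1)
        = (1 - t ^ 2) ^ m * (1 - t ^ 2) ^ 6 * |v₀ t| ^ (12 / (m : ℝ) + 2) := by
      have ea : ((1 - t ^ 2) ^ m) ^ (6 / (m : ℝ) + 1) = (1 - t ^ 2) ^ m * (1 - t ^ 2) ^ 6 := by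
        rw [← pow_add, ← rpow_natCast, ← rpow_mul hp0, ← rpow_natCast _ (m + 6)]
        congr 1
        push_cast
        field_simp
        ring
      have eb : (v₀ t ^ 2) ^ (6 / (m : ℝ) + 1) = |v₀ t| ^ (12 / (m : ℝ) + 2) := by
        rw [← sq_abs (v₀ t), ← rpow_natCast, ← rpow_mul (abs_nonneg _)]
        congr 1
        push_cast
        ring
      rw [mul_rpow hr (sq_nonneg _), ea, eb]
    rw [hpow] at hY
    have he : (1 - t ^ 2) ^ m * (1 - t ^ 2) ^ 6 * e ≤ |e| := by
      have e1 : (1 - t ^ 2) ^ m * (1 - t ^ 2) ^ 6 ≤ 1 := by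
        rw [← pow_add]; exact pow_le_one₀ hp0 hp1
      have e2 : 0 ≤ (1 - t ^ 2) ^ m * (1 - t ^ 2) ^ 6 := by positivity
      nlinarith [le_abs_self e, abs_nonneg e]
    have hq' := mul_le_mul_of_nonneg_left hq hr
    have hEt := congrArg (fun x => (1 - t ^ 2) ^ m * (1 - t ^ 2) ^ 6 * x) (hE t)
    simp only [hS', hM₀]
    generalize (1 - t ^ 2) ^ m = r at *
    generalize 1 - t ^ 2 = p at *
    linarith
  have hmono : MonotoneOn S (Set.Icc (-1) 1) := by
    refine monotoneOn_of_hasDerivWithinAt_nonneg (convex_Icc _ _)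
      (fun t _ => (hSd t).continuousAt.continuousWithinAt)
      (fun t _ => (hSd t).hasDerivWithinAt) (fun t ht => ?_)
    have ht' := interior_subset ht
    have hp0 : 0 ≤ 1 - t ^ 2 := by nlinarith [ht'.1, ht'.2]
    exact le_trans (by positivity) (key t ht')
  have hJmono : MonotoneOn J (Set.Icc (-1) 1) := by
    refine monotoneOn_of_hasDerivWithinAt_nonneg (convex_Icc _ _)
      (fun t _ => (hJd t).continuousAt.continuousWithinAt)
      (fun t _ => (hJd t).hasDerivWithinAt) (fun t ht => ?_)
    have ht' := interior_subset ht
    have hp0 : 0 ≤ 1 - t ^ 2 := by nlinarith [ht'.1, ht'.2]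
    have hp1 : 1 - t ^ 2 ≤ 1 := by nlinarith [sq_nonneg t]
    have hr : 0 ≤ (1 - t ^ 2) ^ m := pow_nonneg hp0 m
    have hk := mul_le_mul_of_nonneg_left (key t ht') (by positivity : 0 ≤ A)
    have h6 : (1 - t ^ 2) * (-(2 * t)) ≤ 2 := by nlinarith [ht'.1, ht'.2]
    have h7 : (m + 2) * (1 - t ^ 2) * (-(2 * t)) * (v₀ t * v₀ t) ≤ (2 * m + 4) * v₀ t ^ 2 := by
      have := mul_le_mul_of_nonneg_left h6 (by positivity : 0 ≤ ((m : ℝ) + 2) * v₀ t ^ 2)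
      linarith
    have h8 : 2 * (1 - t ^ 2) ^ 2 * (v₀ t * v₁ t) ≤ v₀ t ^ 2 + ((1 - t ^ 2) * v₁ t) ^ 2 := by
      generalize 1 - t ^ 2 = p at *
      have e1 := mul_nonneg hp0 (sq_nonneg (v₀ t - p * v₁ t))
      have e2 := mul_nonneg (sub_nonneg.2 hp1)
        (add_nonneg (sq_nonneg (v₀ t)) (sq_nonneg (p * v₁ t)))
      linarith
    have h9 : (2 * m + 4) * v₀ t ^ 2 + (v₀ t ^ 2 + ((1 - t ^ 2) * v₁ t) ^ 2)
        ≤ A * (v₀ t ^ 2 + ((1 - t ^ 2) * v₁ t) ^ 2) := by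
      rw [hA]
      have : 0 ≤ (2 * (m : ℝ) + 4) * ((1 - t ^ 2) * v₁ t) ^ 2 := by positivity
      linarith
    have h10 := mul_le_mul_of_nonneg_left ((add_le_add h7 h8).trans h9) hr
    linarith
  have hS1 := hmono (by simp : (0 : ℝ) ∈ Set.Icc (-1 : ℝ) 1)
    (by simp : (1 : ℝ) ∈ Set.Icc (-1 : ℝ) 1) zero_le_one
  have hJ1 := hJmono (by simp : (-1 : ℝ) ∈ Set.Icc (-1 : ℝ) 1)
    (by simp : (0 : ℝ) ∈ Set.Icc (-1 : ℝ) 1) (by norm_num)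
  have e1 : S 1 = M₀ := by simp [hS]
  have e2 : J (-1) = -(A * M₀) := by simp [hJ, hS]
  have e3 : J 0 = A * S 0 - v₀ 0 ^ 2 := by simp [hJ, sq]
  rw [e1] at hS1
  rw [e2, e3] at hJ1
  have hAS := mul_le_mul_of_nonneg_left hS1 (by positivity : 0 ≤ A)
  linarith

theorem solutions_of_O6_are_bounded
    (n : ℕ) (hn : 7 ≤ n) (v : ℝ → ℝ) (hv : IsSolO6 n v) :
    ∃ M : ℝ, 0 < M ∧ ∀ t : ℝ, |v t| ≤ M := by
  obtain ⟨hsm, hode⟩ := hv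
  have hn6 : ((n - 6 : ℕ) : ℝ) = (n : ℝ) - 6 := by
    rw [Nat.cast_sub (by omega)]; norm_num
  have hn' : (7 : ℝ) ≤ n := by exact_mod_cast hn
  have hc : 0 < cN n := by
    have h1 : 0 < ((n : ℝ) ^ 2 - 4) * ((n : ℝ) ^ 2 - 16) :=
      mul_pos (by nlinarith) (by nlinarith)
    have h2 : 0 < (n : ℝ) * ((n : ℝ) - 6) := mul_pos (by linarith) (by linarith)
    have h3 := mul_pos h2 h1
    unfold cN
    linarith
  have hd (j : ℕ) (hj : j < 6) (t : ℝ) :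
      HasDerivAt (iteratedDeriv j v) (iteratedDeriv (j + 1) v t) t := by
    rw [iteratedDeriv_succ]
    exact (hsm.differentiable_iteratedDeriv j (by exact_mod_cast hj) t).hasDerivAt
  set b : ℝ := 12 / ((n - 6 : ℕ) : ℝ) with hb
  have hb0 : 0 < b := by rw [hb, hn6]; exact div_pos (by norm_num) (by linarith)
  set H : ℝ → ℝ := fun t =>
    iteratedDeriv 1 v t * iteratedDeriv 5 v t - iteratedDeriv 2 v t * iteratedDeriv 4 v t
      + 1 / 2 * iteratedDeriv 3 v t ^ 2
      - K4 n * (iteratedDeriv 1 v t * iteratedDeriv 3 v t - 1 / 2 * iteratedDeriv 2 v t ^ 2)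
      + K2 n / 2 * iteratedDeriv 1 v t ^ 2 - K0 n / 2 * iteratedDeriv 0 v t ^ 2
      + cN n / (b + 2) * |iteratedDeriv 0 v t| ^ (b + 2) with hH
  have hHd (t : ℝ) : HasDerivAt H 0 t := by
    have d0 := hd 0 (by norm_num) t
    have d1 := hd 1 (by norm_num) t
    have d2 := hd 2 (by norm_num) t
    have d3 := hd 3 (by norm_num) t
    have d4 := hd 4 (by norm_num) t
    have d5 := hd 5 (by norm_num) t
    have dp := ((hasDerivAt_abs_rpow (iteratedDeriv 0 v t)
      (by linarith : 1 < b + 2)).comp t d0).const_mul (cN n / (b + 2))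
    have d := ((((((d1.fun_mul d5).fun_sub (d2.fun_mul d4)).fun_add
      ((d3.fun_pow 2).const_mul (1 / 2))).fun_sub
      (((d1.fun_mul d3).fun_sub ((d2.fun_pow 2).const_mul (1 / 2))).const_mul (K4 n))).fun_add
      ((d1.fun_pow 2).const_mul (K2 n / 2))).fun_sub
      ((d0.fun_pow 2).const_mul (K0 n / 2))).fun_add dp
    refine d.congr_deriv ?_
    have ho := hode t
    rw [← hn6, ← hb] at ho
    have hbb : cN n / (b + 2) * (b + 2) = cN n := div_mul_cancel₀ _ (by linarith)
    have ho' := congrArg (fun x => iteratedDeriv 1 v t * x) ho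
    simp only [iteratedDeriv_zero, add_sub_cancel_right] at ho' ⊢
    linear_combination ho' + |v t| ^ b * v t * iteratedDeriv 1 v t * hbb
  have hHc (t : ℝ) : H t = H 0 :=
    is_const_of_deriv_eq_zero (fun t => (hHd t).differentiableAt) (fun t => (hHd t).deriv) t 0
  obtain ⟨M, hM⟩ := exists_sq_le_of_energy_eq (K4 n) (K2 n) (K0 n) (cN n / (b + 2)) (H 0)
    (by positivity) (n - 6) (by omega)
  refine ⟨|M| + 1, by positivity, fun a => ?_⟩
  have hs (j : ℕ) (hj : j < 6) (t : ℝ) : HasDerivAt (fun t => iteratedDeriv j v (t + a))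
      (iteratedDeriv (j + 1) v (t + a)) t := (hd j hj (t + a)).comp_add_const t a
  have h := hM _ _ _ _ _ _ (hs 0 (by norm_num)) (hs 1 (by norm_num)) (hs 2 (by norm_num))
    (hs 3 (by norm_num)) (hs 4 (by norm_num)) (fun t => hHc (t + a))
  simp only [iteratedDeriv_zero, zero_add] at h
  rw [← sq_abs] at h
  nlinarith [le_abs_self M, abs_nonneg M, abs_nonneg (v a)]
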